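/- Let t ≥ 1 and fix a ∈ [0,1]. Suppose additionally that f is L-Lipschitz on subgradients, i.e. ‖g_s‖ ≤ L for all s = 1,…,t with L > 0, and the projected subgradient method is run with the step-size family η_s = R/(G_s · s^{a/2}), where G_s = max_{1≤j≤s} ‖g_j‖ · j^{(1−a)/2} (each g_s ≠ 0). Then f((1/t)·Σ_{s=1}^t x_s) − f(x*) ≤ 3RL/(2√t). -/

import Mathlib

open scoped RealInnerProductSpace

/-- A nearest point of a convex set to `y` is at least as close to every point of the set as `y`. -/
theorem Convex.norm_sub_le_of_forall_norm_sub_le {E : Type*} [NormedAddCommGroup E]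
    [InnerProductSpace ℝ E] {K : Set E} (hK : Convex ℝ K) {p y z : E} (hp : p ∈ K) (hz : z ∈ K)
    (h : ∀ w ∈ K, ‖p - y‖ ≤ ‖w - y‖) : ‖p - z‖ ≤ ‖y - z‖ := by
  have hinf : ‖y - p‖ = ⨅ w : K, ‖y - w‖ := by
    have : Nonempty K := ⟨⟨p, hp⟩⟩
    refine le_antisymm (le_ciInf fun w => ?_) ?_
    · rw [norm_sub_rev y p, norm_sub_rev y w]
      exact h w w.2
    · exact ciInf_le (f := fun w : K => ‖y - w‖)
        ⟨0, by rintro _ ⟨w, rfl⟩; exact norm_nonneg _⟩ ⟨p, hp⟩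
  have hobt := (norm_eq_iInf_iff_real_inner_le_zero hK hp).1 hinf z hz
  have hexp : ‖y - z‖ ^ 2 = ‖y - p‖ ^ 2 - 2 * ⟪y - p, z - p⟫ + ‖p - z‖ ^ 2 := by
    rw [show y - z = (y - p) - (z - p) by abel, norm_sub_sq_real, norm_sub_rev z p]
  refine le_of_sq_le_sq ?_ (norm_nonneg _)
  nlinarith [sq_nonneg ‖y - p‖]

/-- The one-step estimate of the projected subgradient method. -/
theorem Convex.subgradient_step_le {E : Type*} [NormedAddCommGroup E]
    [InnerProductSpace ℝ E] {K : Set E} (hK : Convex ℝ K) {f : E → ℝ} {x g p z : E} {η : ℝ}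
    (hη : 0 < η) (hp : p ∈ K) (hz : z ∈ K)
    (h : ∀ w ∈ K, ‖p - (x - η • g)‖ ≤ ‖w - (x - η • g)‖)
    (hg : f x + ⟪g, z - x⟫ ≤ f z) :
    f x - f z ≤ η⁻¹ / 2 * (‖x - z‖ ^ 2 - ‖p - z‖ ^ 2) + η * ‖g‖ ^ 2 / 2 := by
  have hle := pow_le_pow_left₀ (norm_nonneg _) (hK.norm_sub_le_of_forall_norm_sub_le hp hz h) 2
  have hexp : ‖x - η • g - z‖ ^ 2 = ‖x - z‖ ^ 2 + 2 * η * ⟪g, z - x⟫ + η ^ 2 * ‖g‖ ^ 2 := by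
    rw [show x - η • g - z = (x - z) - η • g by abel, norm_sub_sq_real, inner_smul_right,
      norm_smul, mul_pow, Real.norm_eq_abs, sq_abs, real_inner_comm, ← neg_sub x z,
      inner_neg_right]
    ring
  rw [hexp] at hle
  have hdiv : η⁻¹ / 2 * (‖p - z‖ ^ 2) ≤
      η⁻¹ / 2 * (‖x - z‖ ^ 2 + 2 * η * ⟪g, z - x⟫ + η ^ 2 * ‖g‖ ^ 2) := by gcongr
  have hsplit : η⁻¹ / 2 * (‖x - z‖ ^ 2 + 2 * η * ⟪g, z - x⟫ + η ^ 2 * ‖g‖ ^ 2) =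
      η⁻¹ / 2 * ‖x - z‖ ^ 2 + ⟪g, z - x⟫ + η * ‖g‖ ^ 2 / 2 := by
    field_simp
  linarith

theorem Real.sqrt_add_one_div_two_mul_sqrt_le {k : ℝ} (hk : 0 ≤ k) :
    √k + 1 / (2 * √(k + 1)) ≤ √(k + 1) := by
  have hpos : 0 < √(k + 1) := Real.sqrt_pos.2 (by linarith)
  have hsq := Real.sq_sqrt hk
  have hsq' := Real.sq_sqrt (show 0 ≤ k + 1 by linarith)
  rw [← le_sub_iff_add_le', div_le_iff₀ (by positivity)]
  nlinarith [sq_nonneg (√(k + 1) - √k)]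

/-- Summation by parts for telescoping estimates with nondecreasing weights. -/
theorem sum_Icc_le_of_weighted_telescope {δ d w : ℕ → ℝ} {D C : ℝ} {t : ℕ} (ht : 1 ≤ t)
    (hC : 0 ≤ C) (hw : ∀ s, 1 ≤ s → s ≤ t → 0 ≤ w s)
    (hmono : ∀ s, 1 ≤ s → s + 1 ≤ t → w s ≤ w (s + 1))
    (hd : ∀ s, 1 ≤ s → 0 ≤ d s ∧ d s ≤ D)
    (hδ : ∀ s, 1 ≤ s → s ≤ t → δ s ≤ w s * (d s - d (s + 1)) + C / (2 * √s)) :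
    ∑ s ∈ Finset.Icc 1 t, δ s ≤ w t * D + C * √t := by
  have key : ∀ k, 1 ≤ k → k ≤ t →
      ∑ s ∈ Finset.Icc 1 k, δ s ≤ w k * D - w k * d (k + 1) + C * √k := by
    intro k hk
    induction k, hk using Nat.le_induction with
    | base =>
      intro h
      have h1 := hδ 1 le_rfl h
      have h2 := mul_le_mul_of_nonneg_left (hd 1 le_rfl).2 (hw 1 le_rfl h)
      simp only [Finset.Icc_self, Finset.sum_singleton, Nat.cast_one, Real.sqrt_one] at h1 ⊢
      linarith
    | succ k hk ih =>
      intro h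
      rw [Finset.sum_Icc_succ_top (by omega)]
      have h1 := hδ (k + 1) (by omega) h
      have h2 := mul_le_mul_of_nonneg_left (hd (k + 1) (by omega)).2
        (sub_nonneg.2 (hmono k hk h))
      have h3 := mul_le_mul_of_nonneg_left
        (Real.sqrt_add_one_div_two_mul_sqrt_le (Nat.cast_nonneg (α := ℝ) k)) hC
      have h4 := ih (by omega)
      push_cast at h1 ⊢
      rw [mul_add, mul_one_div] at h3
      linarith
  have h := key t ht le_rfl
  have hnn := mul_nonneg (hw t ht le_rfl) (hd (t + 1) (by omega)).1
  linarith

theorem ConvexOn.map_average_Icc_le {E : Type*} [AddCommGroup E] [Module ℝ E] {f : E → ℝ}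
    (hf : ConvexOn ℝ Set.univ f) (x : ℕ → E) {t : ℕ} (ht : 1 ≤ t) :
    f ((1 / (t : ℝ)) • ∑ s ∈ Finset.Icc 1 t, x s) ≤
      (1 / (t : ℝ)) * ∑ s ∈ Finset.Icc 1 t, f (x s) := by
  have ht0 : (t : ℝ) ≠ 0 := by positivity
  rw [Finset.smul_sum, Finset.mul_sum]
  refine hf.map_sum_le (fun _ _ => by positivity) ?_ (fun _ _ => Set.mem_univ _)
  simp [ht0]

theorem Real.rpow_mul_rpow_half_eq_sqrt {s : ℝ} (hs : 0 < s) (a : ℝ) :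
    s ^ ((1 - a) / 2) * s ^ (a / 2) = √s := by
  rw [← Real.rpow_add hs, Real.sqrt_eq_rpow]
  congr 1
  ring

theorem stmt3 {n : ℕ} (X : Set (EuclideanSpace ℝ (Fin n)))
    (hXne : X.Nonempty) (hXcl : IsClosed X) (hXcv : Convex ℝ X)
    (R : ℝ) (hR : 0 < R)
    (xstar : EuclideanSpace ℝ (Fin n)) (hxstar : xstar ∈ X)
    (f : EuclideanSpace ℝ (Fin n) → ℝ) (hf : ConvexOn ℝ Set.univ f)
    (hball : X ⊆ Metric.closedBall xstar R)
    (hmin : ∀ z ∈ X, f xstar ≤ f z)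
    (x g : ℕ → EuclideanSpace ℝ (Fin n)) (η : ℕ → ℝ)
    (hx1 : x 1 ∈ X)
    (hηpos : ∀ s, 1 ≤ s → 0 < η s)
    (hsub : ∀ s, 1 ≤ s → ∀ z, f (x s) + ⟪g s, z - x s⟫ ≤ f z)
    (hmem : ∀ s, 1 ≤ s → x (s + 1) ∈ X)
    (hproj : ∀ s, 1 ≤ s → ∀ z ∈ X,
      ‖x (s + 1) - (x s - η s • g s)‖ ≤ ‖z - (x s - η s • g s)‖)
    (a : ℝ) (ha : a ∈ Set.Icc (0 : ℝ) 1)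
    (t : ℕ) (ht : 1 ≤ t)
    (hgne : ∀ s, 1 ≤ s → s ≤ t → g s ≠ 0)
    (G : ℕ → ℝ)
    (hG : ∀ s (hs : 1 ≤ s), G s =
      (Finset.Icc 1 s).sup' (Finset.nonempty_Icc.mpr hs)
        (fun j => ‖g j‖ * (j : ℝ) ^ ((1 - a) / 2)))
    (hη : ∀ s, 1 ≤ s → s ≤ t → η s = R / (G s * (s : ℝ) ^ (a / 2)))
    (L : ℝ) (hL : 0 < L)
    (hLip : ∀ s, 1 ≤ s → s ≤ t → ‖g s‖ ≤ L) :
    f ((1 / (t : ℝ)) • ∑ s ∈ Finset.Icc 1 t, x s) - f xstar ≤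
      3 * R * L / (2 * Real.sqrt t) := by
  obtain ⟨ha0, ha1⟩ := ha
  have hle_G : ∀ s, 1 ≤ s → ∀ j, 1 ≤ j → j ≤ s → ‖g j‖ * (j : ℝ) ^ ((1 - a) / 2) ≤ G s := by
    intro s hs j hj hjs
    rw [hG s hs]
    exact Finset.le_sup' (fun j : ℕ => ‖g j‖ * (j : ℝ) ^ ((1 - a) / 2))
      (Finset.mem_Icc.2 ⟨hj, hjs⟩)
  have hG_le : G t ≤ L * (t : ℝ) ^ ((1 - a) / 2) := by
    rw [hG t ht]
    refine Finset.sup'_le _ _ fun j hj => ?_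
    obtain ⟨hj1, hjt⟩ := Finset.mem_Icc.1 hj
    have hjL := hLip j hj1 hjt
    have hexp : 0 ≤ (1 - a) / 2 := by linarith
    gcongr
  have hG_mono : ∀ s, 1 ≤ s → G s ≤ G (s + 1) := by
    intro s hs
    rw [hG s hs]
    refine Finset.sup'_le _ _ fun j hj => ?_
    obtain ⟨hj1, hjs⟩ := Finset.mem_Icc.1 hj
    exact hle_G (s + 1) (by omega) j hj1 (by omega)
  have hG_nonneg : ∀ s, 1 ≤ s → 0 ≤ G s := fun s hs =>
    le_trans (by positivity) (hle_G s hs s hs le_rfl)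
  have hinv : ∀ s, 1 ≤ s → s ≤ t → (η s)⁻¹ = G s * (s : ℝ) ^ (a / 2) / R := by
    intro s hs hst
    rw [hη s hs hst, inv_div]
  have hnoise : ∀ s, 1 ≤ s → s ≤ t → η s * ‖g s‖ ^ 2 / 2 ≤ R * L / (2 * √s) := by
    intro s hs hst
    have hs0 : (0 : ℝ) < s := by positivity
    have hg0 : 0 < ‖g s‖ := norm_pos_iff.2 (hgne s hs hst)
    have hden : ‖g s‖ * √s ≤ G s * (s : ℝ) ^ (a / 2) := by
      rw [← Real.rpow_mul_rpow_half_eq_sqrt hs0 a, ← mul_assoc]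
      exact mul_le_mul_of_nonneg_right (hle_G s hs s hs le_rfl) (by positivity)
    have hsq : 0 < √(s : ℝ) := Real.sqrt_pos.2 hs0
    calc η s * ‖g s‖ ^ 2 / 2 ≤ R / (‖g s‖ * √s) * ‖g s‖ ^ 2 / 2 := by
          rw [hη s hs hst]
          gcongr
      _ = R * ‖g s‖ / (2 * √s) := by field_simp
      _ ≤ R * L / (2 * √s) := by
          have := hLip s hs hst
          gcongr
  have hxX : ∀ s, 1 ≤ s → x s ∈ X := by
    intro s hs
    obtain rfl | hs' := hs.eq_or_lt
    · exact hx1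
    · obtain ⟨k, rfl⟩ := Nat.exists_eq_add_of_lt hs'
      exact hmem (1 + k) (by omega)
  have hsum : ∑ s ∈ Finset.Icc 1 t, (f (x s) - f xstar) ≤
      (η t)⁻¹ / 2 * R ^ 2 + R * L * √t := by
    refine sum_Icc_le_of_weighted_telescope (d := fun s => ‖x s - xstar‖ ^ 2)
      (w := fun s => (η s)⁻¹ / 2) ht (by positivity) ?_ ?_ ?_ ?_
    · intro s hs _
      have := hηpos s hs
      positivity
    · intro s hs hst
      simp only [hinv s hs (by omega), hinv (s + 1) (by omega) hst]
      have := hG_mono s hs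
      have := hG_nonneg (s + 1) (by omega)
      have hcast : (s : ℝ) ≤ ((s + 1 : ℕ) : ℝ) := by push_cast; linarith
      gcongr
    · intro s hs
      have hdist := hball (hxX s hs)
      rw [mem_closedBall_iff_norm] at hdist
      exact ⟨by positivity, pow_le_pow_left₀ (norm_nonneg _) hdist 2⟩
    · intro s hs hst
      exact (hXcv.subgradient_step_le (hηpos s hs) (hmem s hs) hxstar (hproj s hs)
        (hsub s hs xstar)).trans (by linarith [hnoise s hs hst])
  have ht0 : (0 : ℝ) < t := by positivity
  have hsqrt : 0 < √(t : ℝ) := Real.sqrt_pos.2 ht0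
  have hlast : (η t)⁻¹ / 2 * R ^ 2 ≤ R * L * √t / 2 := by
    have hw : G t * (t : ℝ) ^ (a / 2) ≤ L * √t := by
      rw [← Real.rpow_mul_rpow_half_eq_sqrt ht0 a, ← mul_assoc]
      gcongr
    calc (η t)⁻¹ / 2 * R ^ 2 = R / 2 * (G t * (t : ℝ) ^ (a / 2)) := by
          rw [hinv t ht le_rfl]
          field_simp
      _ ≤ R / 2 * (L * √t) := by gcongr
      _ = R * L * √t / 2 := by ring
  have hgap : f ((1 / (t : ℝ)) • ∑ s ∈ Finset.Icc 1 t, x s) - f xstar ≤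
      (1 / (t : ℝ)) * ∑ s ∈ Finset.Icc 1 t, (f (x s) - f xstar) := by
    have hjensen := hf.map_average_Icc_le x ht
    have hconst : (1 / (t : ℝ)) * (t * f xstar) = f xstar := by field_simp
    simp only [Finset.sum_sub_distrib, Finset.sum_const, Nat.card_Icc, Nat.add_sub_cancel,
      nsmul_eq_mul, mul_sub, hconst]
    linarith
  calc _ ≤ (1 / (t : ℝ)) * ∑ s ∈ Finset.Icc 1 t, (f (x s) - f xstar) := hgap
    _ ≤ (1 / (t : ℝ)) * (3 * R * L * √t / 2) := by
        gcongr
        linarith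
    _ = 3 * R * L / (2 * √t) := by
        have hsq := Real.sq_sqrt ht0.le
        field_simp
        linear_combination hsq
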